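/- arXiv:2310.00663 — 2 statements merged into one kernel-verified Lean document; each statement's English description precedes it below -/
import Mathlib

section
/- Let S be a left-soft separative, (2,ω)-divisible Cu-semigroup satisfying (O5). If x,t ∈ S are strongly soft and y,t' ∈ S satisfy x+t ≤ y+t', t' ≪ t, and t' ≪ ∞y, then x ≤ y. -/
open Set

/-- The way-below relation: `x ≪ y` if for every increasing sequence with a
supremum dominating `y`, some term of the sequence dominates `x`. -/
def WayBelow {S : Type*} [Preorder S] (x y : S) : Prop :=
  ∀ z : ℕ → S, Monotone z → ∀ s : S, IsLUB (Set.range z) s → y ≤ s → ∃ m : ℕ, x ≤ z m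

/-- A Cu-semigroup: a positively ordered commutative monoid satisfying (O1)-(O4). -/
class CuSemigroup (S : Type*) extends AddCommMonoid S, PartialOrder S where
  zero_le : ∀ x : S, 0 ≤ x
  add_mono : ∀ {a b c d : S}, a ≤ b → c ≤ d → a + c ≤ b + d
  O1 : ∀ z : ℕ → S, Monotone z → ∃ s : S, IsLUB (Set.range z) s
  O2 : ∀ x : S, ∃ z : ℕ → S, (∀ n, WayBelow (z n) (z (n + 1))) ∧ IsLUB (Set.range z) x
  O3 : ∀ {x' x y' y : S}, WayBelow x' x → WayBelow y' y → WayBelow (x' + y') (x + y)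
  O4 : ∀ (x y : ℕ → S), Monotone x → Monotone y → ∀ sx sy : S,
      IsLUB (Set.range x) sx → IsLUB (Set.range y) sy →
      IsLUB (Set.range fun n => x n + y n) (sx + sy)

variable {S : Type*}

lemma CuSemigroup.nsmul_mono [CuSemigroup S] (x : S) : Monotone fun n : ℕ => n • x := by
  intro n m h
  obtain ⟨k, rfl⟩ := Nat.exists_eq_add_of_le h
  show n • x ≤ (n + k) • x
  rw [add_nsmul]
  calc n • x = n • x + 0 := by rw [add_zero]
    _ ≤ n • x + k • x := CuSemigroup.add_mono le_rfl (CuSemigroup.zero_le _)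

/-- `infty x` is the supremum of the increasing sequence `n • x`, i.e. `∞x`. -/
noncomputable def infty [CuSemigroup S] (x : S) : S :=
  (CuSemigroup.O1 (fun n : ℕ => n • x) (CuSemigroup.nsmul_mono x)).choose

lemma infty_isLUB [CuSemigroup S] (x : S) :
    IsLUB (Set.range fun n : ℕ => n • x) (infty x) :=
  (CuSemigroup.O1 (fun n : ℕ => n • x) (CuSemigroup.nsmul_mono x)).choose_spec

/-- An element is strongly soft if every `x' ≪ x` admits `t` with `x' + t ≪ x`
and `x' ≪ ∞t`. -/
def StronglySoft [CuSemigroup S] (x : S) : Prop :=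
  ∀ x' : S, WayBelow x' x → ∃ t : S, WayBelow (x' + t) x ∧ WayBelow x' (infty t)

def SatisfiesO5 (S : Type*) [CuSemigroup S] : Prop :=
  ∀ x' x y' y z : S, WayBelow x' x → WayBelow y' y → x + y ≤ z →
    ∃ c : S, WayBelow y' c ∧ x' + c ≤ z ∧ z ≤ x + c

def SatisfiesO6 (S : Type*) [CuSemigroup S] : Prop :=
  ∀ x' x y z : S, WayBelow x' x → WayBelow x (y + z) →
    ∃ v w : S, v ≤ x ∧ v ≤ y ∧ w ≤ x ∧ w ≤ z ∧ x' ≤ v + w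

def SatisfiesO7 (S : Type*) [CuSemigroup S] : Prop :=
  ∀ x' x y' y w : S, WayBelow x' x → x ≤ w → WayBelow y' y → y ≤ w →
    ∃ z : S, WayBelow x' z ∧ WayBelow y' z ∧ z ≤ w ∧ z ≤ x + y

def TwoOmegaDivisible (S : Type*) [CuSemigroup S] : Prop :=
  ∀ x' x : S, WayBelow x' x → ∃ y : S, 2 • y ≤ x ∧ x' ≤ infty y

def WeaklyCancellative (S : Type*) [CuSemigroup S] : Prop :=
  ∀ x y z : S, WayBelow (x + z) (y + z) → WayBelow x y

def Separative (S : Type*) [CuSemigroup S] : Prop :=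
  ∀ x y t : S, WayBelow (x + t) (y + t) → WayBelow t (infty x) → WayBelow t (infty y) →
    WayBelow x y

def LeftSoftSeparative (S : Type*) [CuSemigroup S] : Prop :=
  ∀ x y t : S, StronglySoft x → WayBelow (x + t) (y + t) → WayBelow t (infty x) →
    WayBelow t (infty y) → WayBelow x y

def AlmostUnperforated (S : Type*) [CuSemigroup S] : Prop :=
  ∀ x y : S, (∃ n : ℕ, 1 ≤ n ∧ (n + 1) • x ≤ n • y) → x ≤ y

def CountablyBased (S : Type*) [CuSemigroup S] : Prop :=
  ∃ D : Set S, D.Countable ∧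
    ∀ x : S, ∃ z : ℕ → S, Monotone z ∧ (∀ n, z n ∈ D) ∧ IsLUB (Set.range z) x

/-- `Lset x` is the set `L_x = { u' : u' ≪ u ≪ x for some strongly soft u }`. -/
def Lset [CuSemigroup S] (x : S) : Set S :=
  { u' | ∃ u : S, StronglySoft u ∧ WayBelow u' u ∧ WayBelow u x }

/-- A functional on a Cu-semigroup: a monoid morphism to `[0,∞]` preserving order
and suprema of increasing sequences. -/
structure CuFunctional (S : Type*) [CuSemigroup S] where
  toFun : S → ENNReal
  map_zero : toFun 0 = 0
  map_add : ∀ x y : S, toFun (x + y) = toFun x + toFun y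
  mono : ∀ x y : S, x ≤ y → toFun x ≤ toFun y
  map_sup : ∀ z : ℕ → S, Monotone z → ∀ s : S, IsLUB (Set.range z) s →
    toFun s = ⨆ n, toFun (z n)

/-- Predicate version: `f : S → [0,∞]` is a functional on `S`. -/
def IsCuFunctional [CuSemigroup S] (f : S → ENNReal) : Prop :=
  f 0 = 0 ∧ (∀ x y : S, f (x + y) = f x + f y) ∧ (∀ x y : S, x ≤ y → f x ≤ f y) ∧
  (∀ z : ℕ → S, Monotone z → ∀ s : S, IsLUB (Set.range z) s → f s = ⨆ n, f (z n))

/-- Least upper bound of `A` computed within the subset `T`. -/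
def IsLUBIn [CuSemigroup S] (T : Set S) (A : Set S) (s : S) : Prop :=
  s ∈ T ∧ s ∈ upperBounds A ∧ ∀ b ∈ T, b ∈ upperBounds A → s ≤ b

/-- The way-below relation computed within the subset `T`. -/
def WayBelowIn [CuSemigroup S] (T : Set S) (x y : S) : Prop :=
  ∀ z : ℕ → S, Monotone z → (∀ n, z n ∈ T) → ∀ s : S, IsLUBIn T (Set.range z) s → y ≤ s →
    ∃ m : ℕ, x ≤ z m

/-- `T` is a sub-Cu-semigroup of `S`: a submonoid which is itself a Cu-semigroup
for the inherited order, such that the inclusion preserves suprema of increasing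
sequences and the way-below relation. -/
structure IsSubCuSemigroup [CuSemigroup S] (T : Set S) : Prop where
  zero_mem : (0 : S) ∈ T
  add_mem : ∀ {x y : S}, x ∈ T → y ∈ T → x + y ∈ T
  o1 : ∀ z : ℕ → S, Monotone z → (∀ n, z n ∈ T) → ∃ s : S, IsLUBIn T (Set.range z) s
  o2 : ∀ x ∈ T, ∃ z : ℕ → S, (∀ n, z n ∈ T) ∧ (∀ n, WayBelowIn T (z n) (z (n + 1))) ∧
        IsLUBIn T (Set.range z) x
  o3 : ∀ {x' x y' y : S}, x' ∈ T → x ∈ T → y' ∈ T → y ∈ T →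
        WayBelowIn T x' x → WayBelowIn T y' y → WayBelowIn T (x' + y') (x + y)
  o4 : ∀ (x y : ℕ → S), Monotone x → Monotone y → (∀ n, x n ∈ T) → (∀ n, y n ∈ T) →
        ∀ sx sy : S, IsLUBIn T (Set.range x) sx → IsLUBIn T (Set.range y) sy →
        IsLUBIn T (Set.range fun n => x n + y n) (sx + sy)
  incl_sup : ∀ z : ℕ → S, Monotone z → (∀ n, z n ∈ T) → ∀ s : S,
        IsLUBIn T (Set.range z) s → IsLUB (Set.range z) s
  incl_wayBelow : ∀ {x y : S}, x ∈ T → y ∈ T → WayBelowIn T x y → WayBelow x y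

def SatisfiesO5In [CuSemigroup S] (T : Set S) : Prop :=
  ∀ x' x y' y z : S, x' ∈ T → x ∈ T → y' ∈ T → y ∈ T → z ∈ T →
    WayBelowIn T x' x → WayBelowIn T y' y → x + y ≤ z →
    ∃ c ∈ T, WayBelowIn T y' c ∧ x' + c ≤ z ∧ z ≤ x + c

def SatisfiesO6In [CuSemigroup S] (T : Set S) : Prop :=
  ∀ x' x y z : S, x' ∈ T → x ∈ T → y ∈ T → z ∈ T →
    WayBelowIn T x' x → WayBelowIn T x (y + z) →
    ∃ v ∈ T, ∃ w ∈ T, v ≤ x ∧ v ≤ y ∧ w ≤ x ∧ w ≤ z ∧ x' ≤ v + w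

def SatisfiesO7In [CuSemigroup S] (T : Set S) : Prop :=
  ∀ x' x y' y w : S, x' ∈ T → x ∈ T → y' ∈ T → y ∈ T → w ∈ T →
    WayBelowIn T x' x → x ≤ w → WayBelowIn T y' y → y ≤ w →
    ∃ z ∈ T, WayBelowIn T x' z ∧ WayBelowIn T y' z ∧ z ≤ w ∧ z ≤ x + y

/-- `f` is a functional on the sub-Cu-semigroup `T` (values off `T` are irrelevant). -/
def IsFunctionalOn [CuSemigroup S] (T : Set S) (f : S → ENNReal) : Prop :=
  f 0 = 0 ∧
  (∀ x ∈ T, ∀ y ∈ T, f (x + y) = f x + f y) ∧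
  (∀ x ∈ T, ∀ y ∈ T, x ≤ y → f x ≤ f y) ∧
  (∀ z : ℕ → S, Monotone z → (∀ n, z n ∈ T) → ∀ s : S, IsLUBIn T (Set.range z) s →
    f s = ⨆ n, f (z n))

/-- An element is full if `x ≤ ∞e` for every `x`. -/
def IsFull [CuSemigroup S] (e : S) : Prop := ∀ x : S, x ≤ infty e

/-- Condition (R1) for `r`: comparison of `x` with `y` whenever
`λ(x) + r·λ(e) ≤ λ(y)` for all functionals. -/
def SatisfiesR1 (S : Type*) [CuSemigroup S] (e : S) (r : NNReal) : Prop :=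
  ∀ x y : S,
    (∀ lam : CuFunctional S, lam.toFun x + (r : ENNReal) * lam.toFun e ≤ lam.toFun y) → x ≤ y

/-- The radius of comparison of `(S, e)`. -/
noncomputable def rc (S : Type*) [CuSemigroup S] (e : S) : ENNReal :=
  ⨅ r ∈ {r : NNReal | 0 < r ∧ SatisfiesR1 S e r}, (r : ENNReal)

/-- Condition (R1) for the sub-Cu-semigroup `T`. -/
def SatisfiesR1On [CuSemigroup S] (T : Set S) (e : S) (r : NNReal) : Prop :=
  ∀ x ∈ T, ∀ y ∈ T,
    (∀ f : S → ENNReal, IsFunctionalOn T f → f x + (r : ENNReal) * f e ≤ f y) → x ≤ y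

/-- The radius of comparison of `(T, e)` for a sub-Cu-semigroup `T ⊆ S`. -/
noncomputable def rcOn [CuSemigroup S] (T : Set S) (e : S) : ENNReal :=
  ⨅ r ∈ {r : NNReal | 0 < r ∧ SatisfiesR1On T e r}, (r : ENNReal)

/-- `dim S ≤ n` in the sense of covering dimension of Cu-semigroups. -/
def DimLe (S : Type*) [CuSemigroup S] (n : ℕ) : Prop :=
  ∀ (x' x : S) (r : ℕ) (y : Fin r → S), WayBelow x' x → WayBelow x (∑ j, y j) →
    ∃ z : Fin r → Fin (n + 1) → S,
      (∀ j k, WayBelow (z j k) (y j)) ∧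
      WayBelow x' (∑ j, ∑ k, z j k) ∧
      (∀ k, WayBelow (∑ j, z j k) x)

/-- The covering dimension of a Cu-semigroup, in `ℕ ∪ {∞}`. -/
noncomputable def cuDim (S : Type*) [CuSemigroup S] : ℕ∞ :=
  ⨅ n ∈ {n : ℕ | DimLe S n}, (n : ℕ∞)

/-- `dim T ≤ n` for a sub-Cu-semigroup `T ⊆ S`. -/
def DimLeOn [CuSemigroup S] (T : Set S) (n : ℕ) : Prop :=
  ∀ (x' x : S), x' ∈ T → x ∈ T → ∀ (r : ℕ) (y : Fin r → S), (∀ j, y j ∈ T) →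
    WayBelowIn T x' x → WayBelowIn T x (∑ j, y j) →
    ∃ z : Fin r → Fin (n + 1) → S,
      (∀ j k, z j k ∈ T) ∧
      (∀ j k, WayBelowIn T (z j k) (y j)) ∧
      WayBelowIn T x' (∑ j, ∑ k, z j k) ∧
      (∀ k, WayBelowIn T (∑ j, z j k) x)

/-- The covering dimension of a sub-Cu-semigroup `T ⊆ S`. -/
noncomputable def cuDimOn [CuSemigroup S] (T : Set S) : ℕ∞ :=
  ⨅ n ∈ {n : ℕ | DimLeOn T n}, (n : ℕ∞)

instance CuSemigroup.isOrderedAddMonoid [CuSemigroup S] : IsOrderedAddMonoid S where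
  add_le_add_left _ _ h _ := CuSemigroup.add_mono h le_rfl

lemma WayBelow.le [Preorder S] {x y : S} (h : WayBelow x y) : x ≤ y := by
  obtain ⟨_, hm⟩ := h (fun _ => y) monotone_const y (by simp) le_rfl
  exact hm

lemma WayBelow.trans_le [Preorder S] {x y z : S} (h : WayBelow x y) (hyz : y ≤ z) :
    WayBelow x z :=
  fun w hw s hs hz => h w hw s hs (hyz.trans hz)

lemma WayBelow.of_le [Preorder S] {x y z : S} (hxy : x ≤ y) (h : WayBelow y z) :
    WayBelow x z :=
  fun w hw s hs hz => (h w hw s hs hz).imp fun _ hm => hxy.trans hm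

lemma CuSemigroup.le_of_forall_wayBelow [CuSemigroup S] {x y : S}
    (h : ∀ x', WayBelow x' x → x' ≤ y) : x ≤ y := by
  obtain ⟨z, hz, hlub⟩ := CuSemigroup.O2 x
  refine hlub.2 ?_
  rintro _ ⟨n, rfl⟩
  exact h _ ((hz n).trans_le (hlub.1 ⟨n + 1, rfl⟩))

lemma WayBelow.exists_between [CuSemigroup S] {x y : S} (h : WayBelow x y) :
    ∃ w : S, WayBelow x w ∧ WayBelow w y := by
  obtain ⟨z, hz, hlub⟩ := CuSemigroup.O2 y
  obtain ⟨m, hm⟩ := h z (monotone_nat_of_le_succ fun n => (hz n).le) y hlub le_rfl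
  exact ⟨z (m + 1), (hz m).of_le hm, (hz (m + 1)).trans_le (hlub.1 ⟨m + 2, rfl⟩)⟩

lemma CuSemigroup.isLUB_nsmul [CuSemigroup S] {z : ℕ → S} {x : S} (hz : Monotone z)
    (hx : IsLUB (Set.range z) x) (n : ℕ) :
    IsLUB (Set.range fun k => n • z k) (n • x) := by
  induction n with
  | zero => simp
  | succ n ih =>
    simp only [succ_nsmul]
    exact CuSemigroup.O4 _ _ (fun _ _ h => nsmul_le_nsmul_right (hz h) n) hz _ _ ih hx

lemma nsmul_le_infty [CuSemigroup S] (n : ℕ) (x : S) : n • x ≤ infty x :=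
  (infty_isLUB x).1 ⟨n, rfl⟩

lemma le_infty [CuSemigroup S] (x : S) : x ≤ infty x := by
  simpa using nsmul_le_infty 1 x

lemma infty_mono [CuSemigroup S] {x y : S} (h : x ≤ y) : infty x ≤ infty y := by
  refine (infty_isLUB x).2 ?_
  rintro _ ⟨n, rfl⟩
  exact (nsmul_le_nsmul_right h n).trans (nsmul_le_infty n y)

lemma infty_add_infty [CuSemigroup S] (x : S) : infty x + infty x = infty x := by
  refine le_antisymm ?_ (le_add_of_nonneg_right (CuSemigroup.zero_le _))
  refine (CuSemigroup.O4 _ _ (CuSemigroup.nsmul_mono x) (CuSemigroup.nsmul_mono x) _ _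
    (infty_isLUB x) (infty_isLUB x)).2 ?_
  rintro _ ⟨n, rfl⟩
  simpa only [← add_nsmul] using nsmul_le_infty (n + n) x

lemma add_le_infty [CuSemigroup S] {a b x : S} (ha : a ≤ infty x) (hb : b ≤ infty x) :
    a + b ≤ infty x :=
  (add_le_add ha hb).trans_eq (infty_add_infty x)

lemma WayBelow.add_infty [CuSemigroup S] {a b x : S} (ha : WayBelow a (infty x))
    (hb : WayBelow b (infty x)) : WayBelow (a + b) (infty x) :=
  (CuSemigroup.O3 ha hb).trans_le (infty_add_infty x).le

lemma infty_le_infty [CuSemigroup S] {x y : S} (h : x ≤ infty y) : infty x ≤ infty y := by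
  refine (infty_isLUB x).2 ?_
  rintro _ ⟨n, rfl⟩
  induction n with
  | zero => simpa using CuSemigroup.zero_le (infty y)
  | succ n ih =>
    simp only [succ_nsmul]
    exact add_le_infty ih h

lemma WayBelow.exists_infty [CuSemigroup S] {a b : S} (h : WayBelow a (infty b)) :
    ∃ b' : S, WayBelow b' b ∧ WayBelow a (infty b') := by
  obtain ⟨a₁, haa₁, ha₁⟩ := h.exists_between
  obtain ⟨a₂, ha₁₂, ha₂⟩ := ha₁.exists_between
  obtain ⟨n, hn⟩ := ha₂ _ (CuSemigroup.nsmul_mono b) _ (infty_isLUB b) le_rfl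
  obtain ⟨z, hz, hlub⟩ := CuSemigroup.O2 b
  have hmono : Monotone z := monotone_nat_of_le_succ fun n => (hz n).le
  obtain ⟨k, hk⟩ := ha₁₂ _ (fun _ _ h => nsmul_le_nsmul_right (hmono h) n) _
    (CuSemigroup.isLUB_nsmul hmono hlub n) hn
  exact ⟨z k, (hz k).trans_le (hlub.1 ⟨k + 1, rfl⟩),
    haa₁.trans_le (hk.trans (nsmul_le_infty n _))⟩

lemma WayBelow.exists_add [CuSemigroup S] {a b c : S} (h : WayBelow a (b + c)) :
    ∃ b' c' : S, WayBelow b' b ∧ WayBelow c' c ∧ a ≤ b' + c' := by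
  obtain ⟨z, hz, hb⟩ := CuSemigroup.O2 b
  obtain ⟨w, hw, hc⟩ := CuSemigroup.O2 c
  have hzm : Monotone z := monotone_nat_of_le_succ fun n => (hz n).le
  have hwm : Monotone w := monotone_nat_of_le_succ fun n => (hw n).le
  obtain ⟨k, hk⟩ := h _ (hzm.add hwm) _ (CuSemigroup.O4 z w hzm hwm b c hb hc) le_rfl
  exact ⟨z k, w k, (hz k).trans_le (hb.1 ⟨k + 1, rfl⟩), (hw k).trans_le (hc.1 ⟨k + 1, rfl⟩), hk⟩

/-- Adding to a strongly soft element something in the ideal it generates gives a strongly soft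
element. -/
lemma StronglySoft.add_of_le_infty [CuSemigroup S] {a u : S} (hu : StronglySoft u)
    (ha : a ≤ infty u) : StronglySoft (a + u) := by
  intro w hw
  obtain ⟨w₁, hww₁, hw₁⟩ := hw.exists_between
  obtain ⟨a₁, u₁, ha₁, hu₁, hle⟩ := hw₁.exists_add
  obtain ⟨u₂, hu₂, ha₁u₂⟩ := (ha₁.trans_le ha).exists_infty
  obtain ⟨z, hz, hlub⟩ := CuSemigroup.O2 u
  have hzm : Monotone z := monotone_nat_of_le_succ fun n => (hz n).le
  obtain ⟨k, hk⟩ := hu₁ z hzm u hlub le_rfl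
  obtain ⟨l, hl⟩ := hu₂ z hzm u hlub le_rfl
  obtain ⟨v, hv, hv'⟩ := hu (z (max k l))
    ((hz _).trans_le (hlub.1 ⟨max k l + 1, rfl⟩))
  have hk' : u₁ ≤ z (max k l) := hk.trans (hzm (le_max_left k l))
  have hl' : u₂ ≤ z (max k l) := hl.trans (hzm (le_max_right k l))
  refine ⟨v, ?_, ?_⟩
  · refine (CuSemigroup.O3 ha₁ hv).of_le ?_
    calc w + v ≤ (a₁ + u₁) + v := by gcongr; exact hww₁.le.trans hle
      _ = a₁ + (u₁ + v) := add_assoc _ _ _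
      _ ≤ a₁ + (z (max k l) + v) := by gcongr
  · refine hww₁.trans_le (hle.trans (add_le_infty ?_ (hk'.trans hv'.le)))
    exact ha₁u₂.le.trans (infty_le_infty (hl'.trans hv'.le))

/-- A sum `c 0 + c 1 + ⋯` is strongly soft if each summand is way-below a multiple of the next. -/
lemma stronglySoft_of_isLUB_sum [CuSemigroup S] {c : ℕ → S} {u : S}
    (hc : ∀ n, WayBelow (c n) (infty (c (n + 1))))
    (hu : IsLUB (Set.range fun n => ∑ i ∈ Finset.range n, c i) u) : StronglySoft u := by
  have hmono : Monotone fun n => ∑ i ∈ Finset.range n, c i := by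
    refine monotone_nat_of_le_succ fun n => ?_
    rw [Finset.sum_range_succ]
    exact le_add_of_nonneg_right (CuSemigroup.zero_le _)
  have hsum : ∀ n, ∑ i ∈ Finset.range n, c i ≤ infty (c n) := by
    intro n
    induction n with
    | zero => simpa using CuSemigroup.zero_le (infty (c 0))
    | succ n ih =>
      rw [Finset.sum_range_succ]
      exact add_le_infty (ih.trans (infty_le_infty (hc n).le)) (hc n).le
  intro w hw
  obtain ⟨w₁, hww₁, hw₁⟩ := hw.exists_between
  obtain ⟨n, hn⟩ := hw₁ _ hmono u hu le_rfl
  have hn : w₁ ≤ ∑ i ∈ Finset.range n, c i := hn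
  obtain ⟨t, ht, hwt⟩ := (hww₁.trans_le (hn.trans (hsum n))).exists_infty
  refine ⟨t, (CuSemigroup.O3 (hww₁.trans_le hn) ht).trans_le ?_, hwt⟩
  rw [← Finset.sum_range_succ]
  exact hu.1 ⟨n + 1, rfl⟩

/-- In a `(2,ω)`-divisible Cu-semigroup there are enough strongly soft elements. -/
lemma TwoOmegaDivisible.exists_stronglySoft [CuSemigroup S] (hdiv : TwoOmegaDivisible S)
    {e' e : S} (he : WayBelow e' e) :
    ∃ u : S, StronglySoft u ∧ u ≤ e ∧ WayBelow e' (infty u) := by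
  have step : ∀ p : {p : S × S // WayBelow p.1 p.2}, ∃ q : {q : S × S // WayBelow q.1 q.2},
      2 • q.1.2 ≤ p.1.2 ∧ WayBelow p.1.1 (infty q.1.1) := by
    rintro ⟨⟨c, d⟩, hcd⟩
    obtain ⟨c', hcc', hc'd⟩ := hcd.exists_between
    obtain ⟨d₁, hd₁, hc'd₁⟩ := hdiv c' d hc'd
    obtain ⟨c₁, hc₁, hcc₁⟩ := (hcc'.trans_le hc'd₁).exists_infty
    exact ⟨⟨(c₁, d₁), hc₁⟩, hd₁, hcc₁⟩
  choose f hf₁ hf₂ using step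
  let p : ℕ → {p : S × S // WayBelow p.1 p.2} := fun n => f^[n] ⟨(e', e), he⟩
  have hp : ∀ n, p (n + 1) = f (p n) := fun n => Function.iterate_succ_apply' f n _
  have hd : ∀ n, 2 • (p (n + 1)).1.2 ≤ (p n).1.2 := fun n => by rw [hp]; exact hf₁ _
  have hc : ∀ n, WayBelow (p n).1.1 (infty (p (n + 1)).1.1) := fun n => by
    rw [hp]; exact hf₂ _
  have hbound : ∀ n, ∑ i ∈ Finset.range n, (p (i + 1)).1.1 + (p n).1.2 ≤ e := by
    intro n
    induction n with
    | zero => simp [p]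
    | succ n ih =>
      refine le_trans ?_ ih
      rw [Finset.sum_range_succ, add_assoc]
      gcongr
      refine le_trans ?_ (hd n)
      rw [two_nsmul]
      gcongr
      exact (p (n + 1)).2.le
  have hmono : Monotone fun n => ∑ i ∈ Finset.range n, (p (i + 1)).1.1 := by
    refine monotone_nat_of_le_succ fun n => ?_
    rw [Finset.sum_range_succ]
    exact le_add_of_nonneg_right (CuSemigroup.zero_le _)
  obtain ⟨u, hu⟩ := CuSemigroup.O1 _ hmono
  refine ⟨u, stronglySoft_of_isLUB_sum (fun n => hc (n + 1)) hu, hu.2 ?_, ?_⟩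
  · rintro _ ⟨n, rfl⟩
    exact (le_add_of_nonneg_right (CuSemigroup.zero_le _)).trans (hbound n)
  · refine (hc 0).trans_le (infty_mono (hu.1 ⟨1, ?_⟩))
    simp

/-- Cancellation of strongly soft elements in left-soft separative,
(2,ω)-divisible Cu-semigroups satisfying (O5). -/
theorem cancel_soft {S : Type*} [CuSemigroup S]
    (hsep : LeftSoftSeparative S) (hdiv : TwoOmegaDivisible S) (hO5 : SatisfiesO5 S)
    {x t y t' : S} (hx : StronglySoft x) (ht : StronglySoft t)
    (h1 : x + t ≤ y + t') (h2 : WayBelow t' t) (h3 : WayBelow t' (infty y)) :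
    x ≤ y := by
  refine CuSemigroup.le_of_forall_wayBelow fun x' hx' => ?_
  obtain ⟨x₁, hx'x₁, hx₁⟩ := hx'.exists_between
  obtain ⟨r, hr, hx₁r⟩ := hx x₁ hx₁
  obtain ⟨t₁, ht't₁, ht₁⟩ := h2.exists_between
  obtain ⟨s, hs, ht₁s⟩ := ht t₁ ht₁
  have hr_le : r ≤ r + s := le_add_of_nonneg_right (CuSemigroup.zero_le _)
  have hs_le : s ≤ r + s := le_add_of_nonneg_left (CuSemigroup.zero_le _)
  have hsum : WayBelow (x₁ + t₁) (infty (r + s)) :=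
    (hx₁r.trans_le (infty_mono hr_le)).add_infty (ht₁s.trans_le (infty_mono hs_le))
  obtain ⟨e', he', hsum'⟩ := hsum.exists_infty
  obtain ⟨e, he'e, he⟩ := he'.exists_between
  obtain ⟨u, hu, hue, he'u⟩ := hdiv.exists_stronglySoft he'e
  have hle : x₁ + t₁ ≤ infty u := hsum'.le.trans (infty_le_infty he'u.le)
  have hx'u : x' ≤ infty u :=
    (hx'x₁.le.trans (le_add_of_nonneg_right (CuSemigroup.zero_le _))).trans hle
  have ht'u : WayBelow t' (infty (x' + u)) :=
    ht't₁.trans_le (((le_add_of_nonneg_left (CuSemigroup.zero_le _)).trans hle).trans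
      (infty_mono (le_add_of_nonneg_left (CuSemigroup.zero_le _))))
  have key : WayBelow (x' + u + t') (y + t') := by
    refine (CuSemigroup.O3 (CuSemigroup.O3 hx'x₁ (he.of_le hue)) ht't₁).trans_le ?_
    calc x₁ + (r + s) + t₁ = (x₁ + r) + (t₁ + s) := by abel
      _ ≤ x + t := add_le_add hr.le hs.le
      _ ≤ y + t' := h1
  exact (le_add_of_nonneg_right (CuSemigroup.zero_le _)).trans
    (hsep _ _ _ (hu.add_of_le_infty hx'u) key ht'u h3).le
end

section
/- Let S be a countably based, (2,ω)-divisible Cu-semigroup satisfying (O5), (O6) and (O7), let x',x ∈ S with x' ≪ x, let k ∈ ℕ, and let u' ∈ L_x. Then for every finite subset C ⊆ L_x there exists a strongly soft element w' ∈ L_x such that u' ≪ w', x' ≪ ∞w', and k·λ(v') ≤ (k+1)·λ(w') for every functional λ ∈ F(S) and every v' ∈ C. -/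
open Set

variable {S : Type*}

lemma WayBelow.add [CuSemigroup S] {a b c d : S} (h₁ : WayBelow a b) (h₂ : WayBelow c d) :
    WayBelow (a + c) (b + d) :=
  CuSemigroup.O3 h₁ h₂

namespace CuSemigroup

variable [CuSemigroup S]

instance : IsOrderedAddMonoid S where
  add_le_add_left _ _ h _ := add_mono h le_rfl

lemma zero_wayBelow (x : S) : WayBelow 0 x :=
  fun z _ _ _ _ => ⟨0, zero_le (z 0)⟩

lemma le_add_right' (x y : S) : x ≤ x + y :=
  le_add_of_nonneg_right (zero_le y)

lemma le_add_left' (x y : S) : x ≤ y + x :=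
  le_add_of_nonneg_left (zero_le y)

lemma nsmul_wayBelow {x y : S} (h : WayBelow x y) (n : ℕ) : WayBelow (n • x) (n • y) := by
  induction n with
  | zero => simpa using zero_wayBelow (0 : S)
  | succ n ih => simpa [succ_nsmul] using ih.add h

/-- A form of (O2): every element is the supremum of an increasing sequence, each of whose terms
is way below the next term and below the element itself. -/
lemma exists_seq (x : S) : ∃ z : ℕ → S, Monotone z ∧ (∀ n, WayBelow (z n) (z (n + 1))) ∧
    (∀ n, WayBelow (z n) x) ∧ IsLUB (Set.range z) x := by
  obtain ⟨z, hz, hlub⟩ := O2 x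
  exact ⟨z, monotone_nat_of_le_succ fun n => (hz n).le, hz,
    fun n => (hz n).trans_le (hlub.1 ⟨n + 1, rfl⟩), hlub⟩

lemma exists_between {x y : S} (h : WayBelow x y) : ∃ w, WayBelow x w ∧ WayBelow w y := by
  obtain ⟨z, hz, hzs, hzy, hlub⟩ := exists_seq y
  obtain ⟨n, hn⟩ := h z hz y hlub le_rfl
  exact ⟨z (n + 1), .of_le hn (hzs n), hzy _⟩

lemma exists_between₂ {x₁ x₂ y : S} (h₁ : WayBelow x₁ y) (h₂ : WayBelow x₂ y) :
    ∃ w, WayBelow x₁ w ∧ WayBelow x₂ w ∧ WayBelow w y := by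
  obtain ⟨z, hz, hzs, hzy, hlub⟩ := exists_seq y
  obtain ⟨n, hn⟩ := h₁ z hz y hlub le_rfl
  obtain ⟨m, hm⟩ := h₂ z hz y hlub le_rfl
  exact ⟨z (max n m + 1), .of_le (hn.trans (hz (le_max_left n m))) (hzs _),
    .of_le (hm.trans (hz (le_max_right n m))) (hzs _), hzy _⟩

lemma exists_upperBound_of_finite {y : S} {C : Set S} (hC : C.Finite)
    (h : ∀ c ∈ C, WayBelow c y) : ∃ w, (∀ c ∈ C, c ≤ w) ∧ WayBelow w y := by
  induction C, hC using Set.Finite.induction_on with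
  | empty => exact ⟨0, by simp, zero_wayBelow y⟩
  | @insert a s _ _ ih =>
    obtain ⟨w, hw, hwy⟩ := ih fun c hc => h c (Set.mem_insert_of_mem _ hc)
    obtain ⟨w₁, haw, hww, hwy₁⟩ := exists_between₂ (h a (Set.mem_insert _ _)) hwy
    refine ⟨w₁, ?_, hwy₁⟩
    rintro c (rfl | hc)
    · exact haw.le
    · exact (hw c hc).trans hww.le

lemma exists_wayBelow_add {a b c : S} (h : WayBelow a (b + c)) :
    ∃ b' c', WayBelow b' b ∧ WayBelow c' c ∧ a ≤ b' + c' := by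
  obtain ⟨f, hf, -, hfb, hflub⟩ := exists_seq b
  obtain ⟨g, hg, -, hgc, hglub⟩ := exists_seq c
  obtain ⟨n, hn⟩ := h (fun n => f n + g n) (hf.add hg) (b + c) (O4 f g hf hg b c hflub hglub) le_rfl
  exact ⟨f n, g n, hfb n, hgc n, hn⟩

/-! ### The element `∞x` -/

lemma nsmul_le_infty (n : ℕ) (x : S) : n • x ≤ infty x :=
  (infty_isLUB x).1 ⟨n, rfl⟩

lemma le_infty (x : S) : x ≤ infty x := by
  simpa using nsmul_le_infty 1 x

lemma add_le_infty {a b x : S} (ha : a ≤ infty x) (hb : b ≤ infty x) : a + b ≤ infty x := by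
  refine (add_mono ha hb).trans ((O4 _ _ (nsmul_mono x) (nsmul_mono x) _ _
    (infty_isLUB x) (infty_isLUB x)).2 ?_)
  rintro _ ⟨n, rfl⟩
  simpa [add_nsmul] using nsmul_le_infty (n + n) x

lemma nsmul_le_infty_of_le {a x : S} (ha : a ≤ infty x) (n : ℕ) : n • a ≤ infty x := by
  induction n with
  | zero => simpa using zero_le (infty x)
  | succ n ih => simpa [succ_nsmul] using add_le_infty ih ha

lemma infty_le_infty {a x : S} (ha : a ≤ infty x) : infty a ≤ infty x := by
  refine (infty_isLUB a).2 ?_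
  rintro _ ⟨n, rfl⟩
  exact nsmul_le_infty_of_le ha n

lemma isLUB_nsmul_s6 {z : ℕ → S} (hz : Monotone z) {b : S} (hb : IsLUB (Set.range z) b) (k : ℕ) :
    IsLUB (Set.range fun n => k • z n) (k • b) := by
  induction k with
  | zero => simp [Set.range_const]
  | succ k ih =>
    simpa [succ_nsmul] using
      O4 (fun n => k • z n) z (fun i j h => nsmul_le_nsmul_right (hz h) k) hz _ _ ih hb

lemma exists_wayBelow_infty {a b : S} (h : WayBelow a (infty b)) :
    ∃ b', WayBelow b' b ∧ WayBelow a (infty b') := by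
  obtain ⟨a₁, haa, ha⟩ := exists_between h
  obtain ⟨z, hz, -, hzb, hlub⟩ := exists_seq b
  have hmono : Monotone fun n => n • z n := fun i j hij =>
    (nsmul_le_nsmul_right (hz hij) i).trans (nsmul_mono _ hij)
  obtain ⟨s, hs⟩ := O1 _ hmono
  have hbs : infty b ≤ s := by
    refine (infty_isLUB b).2 ?_
    rintro _ ⟨k, rfl⟩
    refine (isLUB_nsmul_s6 hz hlub k).2 ?_
    rintro _ ⟨n, rfl⟩
    calc k • z n ≤ k • z (max k n) := nsmul_le_nsmul_right (hz (le_max_right k n)) k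
      _ ≤ max k n • z (max k n) := nsmul_mono _ (le_max_left k n)
      _ ≤ s := hs.1 ⟨max k n, rfl⟩
  obtain ⟨n, hn⟩ := ha _ hmono s hs hbs
  exact ⟨z n, hzb n, haa.trans_le (hn.trans (nsmul_le_infty n (z n)))⟩

/-! ### Divisibility and strongly soft elements -/

lemma exists_nsmul_le (hdiv : TwoOmegaDivisible S) (n : ℕ) {x' x : S} (h : WayBelow x' x) :
    ∃ y : S, n • y ≤ x ∧ x' ≤ infty y := by
  suffices H : ∀ m : ℕ, ∃ y : S, 2 ^ m • y ≤ x ∧ x' ≤ infty y by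
    obtain ⟨y, hy, hx'⟩ := H n
    exact ⟨y, (nsmul_mono y Nat.lt_two_pow_self.le).trans hy, hx'⟩
  intro m
  induction m generalizing x' x with
  | zero => exact ⟨x, by simp, h.le.trans (le_infty x)⟩
  | succ m ih =>
    obtain ⟨x₁, h₁, h₂⟩ := exists_between h
    obtain ⟨y, hy, hx₁⟩ := ih h₂
    obtain ⟨y', hy', hx'⟩ := exists_wayBelow_infty (h₁.trans_le hx₁)
    obtain ⟨w, hw, hyw⟩ := hdiv y' y hy'
    refine ⟨w, ?_, hx'.le.trans (infty_le_infty hyw)⟩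
    calc 2 ^ (m + 1) • w = 2 ^ m • 2 • w := by rw [pow_succ, mul_nsmul']
      _ ≤ 2 ^ m • y := nsmul_le_nsmul_right hw _
      _ ≤ x := hy

lemma stronglySoft_add {y r : S} (hr : StronglySoft r) (hy : y ≤ infty r) :
    StronglySoft (y + r) := by
  intro q hq
  obtain ⟨y', r', hy', hr', hqle⟩ := exists_wayBelow_add hq
  obtain ⟨r₁, hr₁, hyr₁⟩ := exists_wayBelow_infty (hy'.trans_le hy)
  obtain ⟨r₂, hr'₂, hr₁₂, hr₂⟩ := exists_between₂ hr' hr₁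
  obtain ⟨t, ht, hrt⟩ := hr r₂ hr₂
  refine ⟨t, ?_, ?_⟩
  · refine .of_le ?_ (hy'.add ht)
    rw [← add_assoc]
    exact add_mono (hqle.trans (add_mono le_rfl hr'₂.le)) le_rfl
  · have hyt : WayBelow y' (infty t) := hyr₁.trans_le (infty_le_infty (hr₁₂.le.trans hrt.le))
    have := hyt.add (WayBelow.of_le hr'₂.le hrt)
    exact WayBelow.of_le hqle (this.trans_le (add_le_infty le_rfl le_rfl))

lemma exists_stronglySoft_le (hdiv : TwoOmegaDivisible S) {x' x : S} (h : WayBelow x' x) :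
    ∃ r : S, StronglySoft r ∧ r ≤ x ∧ x' ≤ infty r := by
  have step : ∀ p : {p : S × S // WayBelow p.1 p.2}, ∃ q : {p : S × S // WayBelow p.1 p.2},
      2 • q.1.2 ≤ p.1.2 ∧ WayBelow p.1.1 (infty q.1.1) := by
    rintro ⟨⟨y', y⟩, hy⟩
    obtain ⟨y₁, h₁, h₂⟩ := exists_between hy
    obtain ⟨z, hz, hyz⟩ := hdiv y₁ y h₂
    obtain ⟨z', hz', hyz'⟩ := exists_wayBelow_infty (h₁.trans_le hyz)
    exact ⟨⟨(z', z), hz'⟩, hz, hyz'⟩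
  choose next hnext using step
  let p : ℕ → {p : S × S // WayBelow p.1 p.2} := fun n => next^[n] ⟨(x', x), h⟩
  have hp : ∀ n, p (n + 1) = next (p n) := fun n => Function.iterate_succ_apply' _ _ _
  let a : ℕ → S := fun n => (p n).1.1
  let b : ℕ → S := fun n => (p n).1.2
  have hab : ∀ n, WayBelow (a n) (b n) := fun n => (p n).2
  have hb : ∀ n, 2 • b (n + 1) ≤ b n := fun n => by
    simpa only [b, hp] using (hnext (p n)).1
  have ha : ∀ n, WayBelow (a n) (infty (a (n + 1))) := fun n => by
    simpa only [a, hp] using (hnext (p n)).2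
  let r : ℕ → S := fun n => ∑ i ∈ Finset.range n, a (i + 1)
  have hr_succ : ∀ n, r (n + 1) = r n + a (n + 1) := fun n => Finset.sum_range_succ _ _
  have hr : Monotone r := monotone_nat_of_le_succ fun n => by
    rw [hr_succ]; exact le_add_right' _ _
  have hrb : ∀ n, r n + b n ≤ x := by
    intro n
    induction n with
    | zero => simp [r, b, p]
    | succ n ih =>
      calc r (n + 1) + b (n + 1) ≤ r n + b (n + 1) + b (n + 1) := by
            rw [hr_succ]; exact add_mono (add_mono le_rfl (hab _).le) le_rfl
        _ = r n + 2 • b (n + 1) := by rw [two_nsmul, add_assoc]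
        _ ≤ r n + b n := add_mono le_rfl (hb n)
        _ ≤ x := ih
  have hra : ∀ n, r n ≤ infty (a (n + 1)) := by
    intro n
    induction n with
    | zero => simpa [r] using zero_le _
    | succ n ih =>
      rw [hr_succ]
      exact add_le_infty (ih.trans (infty_le_infty (ha _).le)) (ha _).le
  obtain ⟨s, hs⟩ := O1 r hr
  refine ⟨s, ?_, hs.2 ?_, ?_⟩
  · intro q hq
    obtain ⟨q₁, hq₁, hq₂⟩ := exists_between hq
    obtain ⟨n, hn⟩ := hq₂ r hr s hs le_rfl
    have hqr : WayBelow q (r n) := hq₁.trans_le hn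
    obtain ⟨t, ht, hqt⟩ := exists_wayBelow_infty (hqr.trans_le (hra n))
    refine ⟨t, (hqr.add ht).trans_le ?_, hqt⟩
    rw [← hr_succ]
    exact hs.1 ⟨n + 1, rfl⟩
  · rintro _ ⟨n, rfl⟩
    exact (le_add_right' _ _).trans (hrb n)
  · refine (ha 0).le.trans (infty_le_infty (le_trans ?_ (le_infty s)))
    exact le_trans (by simp [r]) (hs.1 ⟨1, rfl⟩)

lemma exists_stronglySoft_between (hdiv : TwoOmegaDivisible S) {a w : S} (hw : StronglySoft w)
    (h : WayBelow a w) : ∃ s : S, StronglySoft s ∧ WayBelow a s ∧ WayBelow s w := by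
  obtain ⟨a₁, h₁, h₂⟩ := exists_between h
  obtain ⟨t, ht, hat⟩ := hw a₁ h₂
  obtain ⟨t', ht', hat'⟩ := exists_wayBelow_infty hat
  obtain ⟨r, hr, hrt, htr⟩ := exists_stronglySoft_le hdiv ht'
  exact ⟨a₁ + r, stronglySoft_add hr (hat'.le.trans (infty_le_infty htr)),
    h₁.trans_le (le_add_right' _ _), .of_le (add_mono le_rfl hrt) ht⟩

/-- A complement of `u'` in `x` that generates the same ideal as `x`, when `u'` is way below a
strongly soft element below `x`. -/
lemma exists_full_complement (hO5 : SatisfiesO5 S) {u' u x : S} (hu : StronglySoft u)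
    (hu' : WayBelow u' u) (hux : u ≤ x) : ∃ d : S, u' + d ≤ x ∧ x ≤ infty d := by
  obtain ⟨u₁, h₁, h₂⟩ := exists_between hu'
  obtain ⟨t, ht, hut⟩ := hu u₁ h₂
  obtain ⟨t', ht', hut'⟩ := exists_wayBelow_infty hut
  obtain ⟨d, htd, hd, hxd⟩ := hO5 u' u₁ t' t x h₁ ht' (ht.le.trans hux)
  exact ⟨d, hd, hxd.trans
    (add_le_infty (hut'.le.trans (infty_le_infty (htd.le.trans (le_infty d)))) (le_infty d))⟩

/-- The main construction: below `x` there is a strongly soft element lying way above `u'` and,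
up to a factor `(k + 1) / k`, dominating a given element way below `x`. -/
lemma exists_stronglySoft_dominating (hdiv : TwoOmegaDivisible S) (hO5 : SatisfiesO5 S)
    (hO6 : SatisfiesO6 S) (hO7 : SatisfiesO7 S) {x₀ x u' u : S} (hx₀ : WayBelow x₀ x)
    (hu : StronglySoft u) (hu' : WayBelow u' u) (hux : WayBelow u x) (k : ℕ) :
    ∃ s v w : S, StronglySoft s ∧ s ≤ x ∧ WayBelow (u' + (k + 1) • v) s ∧ WayBelow w s ∧
      x₀ ≤ v + w := by
  obtain ⟨x₁, h₀₁, hx₁⟩ := exists_between hx₀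
  obtain ⟨x₂, h₁₂, hux₂, hx₂⟩ := exists_between₂ hx₁ hux
  obtain ⟨u₀, hu₀, hu₀u⟩ := exists_between hu'
  obtain ⟨u₁, hu₁, hu₁u⟩ := exists_between hu₀u
  obtain ⟨d, hd, hxd⟩ := exists_full_complement hO5 hu hu₁u hux.le
  obtain ⟨d', hd', hxd'⟩ := exists_wayBelow_infty (hx₂.trans_le hxd)
  obtain ⟨y, hy, hdy⟩ := exists_nsmul_le hdiv (k + 2) hd'
  obtain ⟨y₀, hy₀, hxy₀⟩ := exists_wayBelow_infty (hxd'.trans_le (infty_le_infty hdy))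
  obtain ⟨y₁, hy₀₁, hy₁⟩ := exists_between hy₀
  obtain ⟨c, hc, hcx, hxc⟩ := hO5 y₀ y₁ (u₀ + (k + 1) • y₁) (u₁ + (k + 1) • y) x hy₀₁
    (hu₁.add (nsmul_wayBelow hy₁ _)) (by
      calc y₁ + (u₁ + (k + 1) • y) ≤ y + (u₁ + (k + 1) • y) := add_mono hy₁.le le_rfl
        _ = u₁ + (k + 2) • y := by rw [succ_nsmul y (k + 1)]; abel
        _ ≤ u₁ + d := add_mono le_rfl hy
        _ ≤ x := hd)
  obtain ⟨v, w, hvx, hvy, hwx, hwc, hvw⟩ := hO6 x₁ x₂ y₁ c h₁₂ (hx₂.trans_le hxc)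
  obtain ⟨v', w', hv', hw', hvw'⟩ := exists_wayBelow_add (h₀₁.trans_le hvw)
  obtain ⟨z, hz, hwz, hzc, hzle⟩ := hO7 (u' + (k + 1) • v') (u₀ + (k + 1) • v) w' w c
    (hu₀.add (nsmul_wayBelow hv' _))
    ((add_mono le_rfl (nsmul_le_nsmul_right hvy _)).trans hc.le) hw' hwc
  obtain ⟨y', hy', hxy'⟩ := exists_wayBelow_infty hxy₀
  obtain ⟨r, hr, hry, hyr⟩ := exists_stronglySoft_le hdiv hy'
  have hxr : x₂ ≤ infty r := hxy'.le.trans (infty_le_infty hyr)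
  have hzr : z ≤ infty r := hzle.trans <| add_le_infty
    (add_le_infty (hu₀u.le.trans (hux₂.le.trans hxr)) (nsmul_le_infty_of_le (hvx.trans hxr) _))
    (hwx.trans hxr)
  refine ⟨z + r, v', w', stronglySoft_add hr hzr, ?_, hz.trans_le (le_add_right' _ _),
    hwz.trans_le (le_add_right' _ _), hvw'⟩
  rw [add_comm]
  exact (add_mono hry hzc).trans hcx

end CuSemigroup

lemma CuFunctional.map_nsmul [CuSemigroup S] (lam : CuFunctional S) (n : ℕ) (x : S) :
    lam.toFun (n • x) = n * lam.toFun x := by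
  induction n with
  | zero => simp [lam.map_zero]
  | succ n ih => rw [succ_nsmul, lam.map_add, ih]; push_cast; ring

/-- In a countably based, (2,ω)-divisible Cu-semigroup satisfying
(O5)-(O7), for `x' ≪ x`, `k ∈ ℕ`, `u' ∈ L_x` and a finite subset `C ⊆ L_x`,
there is a strongly soft `w' ∈ L_x` with `u' ≪ w'`, `x' ≪ ∞w'` and
`k·λ(v') ≤ (k+1)·λ(w')` for every functional `λ` and every `v' ∈ C`. -/
theorem Lset_directed_finite {S : Type*} [CuSemigroup S]
    (hcb : CountablyBased S) (hdiv : TwoOmegaDivisible S)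
    (hO5 : SatisfiesO5 S) (hO6 : SatisfiesO6 S) (hO7 : SatisfiesO7 S)
    {x' x : S} (hxx : WayBelow x' x) (k : ℕ)
    {u' : S} (hu' : u' ∈ Lset x)
    {C : Set S} (hCfin : C.Finite) (hCsub : C ⊆ Lset x) :
    ∃ w' : S, w' ∈ Lset x ∧ StronglySoft w' ∧ WayBelow u' w' ∧
      WayBelow x' (infty w') ∧
      ∀ lam : CuFunctional S, ∀ v' ∈ C,
        (k : ENNReal) * lam.toFun v' ≤ ((k : ENNReal) + 1) * lam.toFun w' := by
  obtain ⟨u, hu, hu'u, hux⟩ := hu'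
  obtain ⟨c, hCc, hcx⟩ := CuSemigroup.exists_upperBound_of_finite hCfin fun v hv => by
    obtain ⟨_, _, hv', hvx⟩ := hCsub hv
    exact WayBelow.of_le hv'.le hvx
  obtain ⟨x₀, hx'₀, hcx₀, hx₀⟩ := CuSemigroup.exists_between₂ hxx hcx
  obtain ⟨s, v, w, hs, hsx, hvs, hws, hx₀vw⟩ :=
    CuSemigroup.exists_stronglySoft_dominating hdiv hO5 hO6 hO7 hx₀ hu hu'u hux k
  obtain ⟨a, hva, hwa, has⟩ := CuSemigroup.exists_between₂ hvs hws
  obtain ⟨w₁, hw₁, haw₁, hw₁s⟩ := CuSemigroup.exists_stronglySoft_between hdiv hs has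
  obtain ⟨w', hw', haw', hw'w₁⟩ := CuSemigroup.exists_stronglySoft_between hdiv hw₁ haw₁
  have hvw' : (k + 1) • v ≤ w' := (CuSemigroup.le_add_left' _ _).trans (hva.le.trans haw'.le)
  have hww' : w ≤ w' := hwa.le.trans haw'.le
  refine ⟨w', ⟨w₁, hw₁, hw'w₁, hw₁s.trans_le hsx⟩, hw',
    .of_le ((CuSemigroup.le_add_right' _ _).trans hva.le) haw', ?_, fun lam v' hv' => ?_⟩
  · refine hx'₀.trans_le (hx₀vw.trans (CuSemigroup.add_le_infty ?_ ?_))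
    · refine le_trans ?_ (hvw'.trans (CuSemigroup.le_infty w'))
      rw [succ_nsmul]
      exact CuSemigroup.le_add_left' _ _
    · exact hww'.trans (CuSemigroup.le_infty w')
  · have key : k • v' ≤ (k + 1) • w' := by
      calc k • v' ≤ k • (v + w) :=
            nsmul_le_nsmul_right ((hCc v' hv').trans (hcx₀.le.trans hx₀vw)) k
        _ = k • v + k • w := nsmul_add _ _ _
        _ ≤ w' + k • w' := CuSemigroup.add_mono
            ((CuSemigroup.nsmul_mono v k.le_succ).trans hvw') (nsmul_le_nsmul_right hww' k)
        _ = (k + 1) • w' := (succ_nsmul' _ _).symm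
    simpa [lam.map_nsmul] using lam.mono _ _ key
end
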